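/- Let H be a generalized barbell with a set of vertex-disjoint eulerian subgraphs B = {B₁, …, B_t}, and assume that {B₁, …, B_s} (with 2 ≤ s ≤ t) is the set of eulerian subgraphs corresponding to the vertices of degree 1 of the contracted graph X = H/(B₁ ∪ … ∪ B_t). If each B_i (1 ≤ i ≤ t) is a circuit, then there is a family F of signed circuits of H such that each edge e of H belongs to: (a) exactly one member of F if e ∈ E(B₁) ∪ … ∪ E(B_s); (b) one or two members of F if e ∈ E(B_{s+1}) ∪ … ∪ E(B_t); and (c) at most one member of F if e ∈ E(H) − (E(B₁) ∪ … ∪ E(B_t)). -/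

import Mathlib

open scoped Classical

noncomputable section

/-- A signed (multi)graph: a finite multigraph (loops and multiple edges allowed)
together with a sign on each edge (`neg e = true` means `e` is negative). -/
structure SignedMultigraph where
  V : Type
  E : Type
  [fintypeV : Fintype V]
  [fintypeE : Fintype E]
  ends : E → Sym2 V
  neg : E → Bool

attribute [instance] SignedMultigraph.fintypeV SignedMultigraph.fintypeE

namespace SignedMultigraph

variable (G : SignedMultigraph)

/-- The vertices incident with at least one edge of `S`. -/
def support (S : Finset G.E) : Finset G.V :=
  Finset.univ.filter fun v => ∃ e ∈ S, v ∈ G.ends e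

/-- Degree of `v` in the edge set `S`; loops count twice. -/
def degIn (S : Finset G.E) (v : G.V) : ℕ :=
  ∑ e ∈ S, (if G.ends e = Sym2.diag v then 2 else if v ∈ G.ends e then 1 else 0)

/-- `u` and `v` are joined by an edge of `S`. -/
def Adj (S : Finset G.E) (u v : G.V) : Prop := ∃ e ∈ S, G.ends e = s(u, v)

/-- Reachability using only edges of `S`. -/
def Reach (S : Finset G.E) : G.V → G.V → Prop := Relation.ReflTransGen (G.Adj S)

/-- The subgraph with edge set `S` (and vertex set its support) is connected. -/
def ConnOn (S : Finset G.E) : Prop :=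
  ∀ u ∈ G.support S, ∀ v ∈ G.support S, G.Reach S u v

/-- The whole signed graph is connected. -/
def Connected : Prop := Nonempty G.V ∧ ∀ u v : G.V, G.Reach Finset.univ u v

/-- The negative edges among `S`. -/
def negEdges (S : Finset G.E) : Finset G.E := S.filter fun e => G.neg e = true

/-- A circuit: a (nonempty) connected 2-regular subgraph, given by its edge set. -/
def IsCircuit (S : Finset G.E) : Prop :=
  S.Nonempty ∧ G.ConnOn S ∧ ∀ v ∈ G.support S, G.degIn S v = 2

/-- A balanced circuit: a circuit with an even number of negative edges. -/
def IsBalancedCircuit (S : Finset G.E) : Prop :=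
  G.IsCircuit S ∧ Even (G.negEdges S).card

/-- An unbalanced circuit: a circuit with an odd number of negative edges. -/
def IsUnbalancedCircuit (S : Finset G.E) : Prop :=
  G.IsCircuit S ∧ ¬ Even (G.negEdges S).card

/-- A short barbell: two unbalanced circuits meeting at exactly one vertex. -/
def IsShortBarbell (S : Finset G.E) : Prop :=
  ∃ C₁ C₂ : Finset G.E, G.IsUnbalancedCircuit C₁ ∧ G.IsUnbalancedCircuit C₂ ∧
    Disjoint C₁ C₂ ∧ (G.support C₁ ∩ G.support C₂).card = 1 ∧ S = C₁ ∪ C₂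

/-- A path with (distinct) ends `u` and `v`, given by its edge set. -/
def IsPath (P : Finset G.E) (u v : G.V) : Prop :=
  P.Nonempty ∧ G.ConnOn P ∧ u ≠ v ∧ u ∈ G.support P ∧ v ∈ G.support P ∧
    G.degIn P u = 1 ∧ G.degIn P v = 1 ∧
    ∀ w ∈ G.support P, w ≠ u → w ≠ v → G.degIn P w = 2

/-- A long barbell: two vertex-disjoint unbalanced circuits joined by a path
meeting the circuits only at its ends. -/
def IsLongBarbell (S : Finset G.E) : Prop :=
  ∃ (C₁ C₂ P : Finset G.E) (u v : G.V),
    G.IsUnbalancedCircuit C₁ ∧ G.IsUnbalancedCircuit C₂ ∧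
    Disjoint (G.support C₁) (G.support C₂) ∧
    G.IsPath P u v ∧
    G.support P ∩ G.support C₁ = {u} ∧ G.support P ∩ G.support C₂ = {v} ∧
    Disjoint P C₁ ∧ Disjoint P C₂ ∧
    S = C₁ ∪ C₂ ∪ P

/-- A signed circuit: a balanced circuit, a short barbell, or a long barbell. -/
def IsSignedCircuit (S : Finset G.E) : Prop :=
  G.IsBalancedCircuit S ∨ G.IsShortBarbell S ∨ G.IsLongBarbell S

/-- The number of members of the family `F` containing the edge `e`. -/
def coverCount (F : Multiset (Finset G.E)) (e : G.E) : ℕ :=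
  (F.filter fun S => e ∈ S).card

/-- The total length of the family `F`. -/
def coverLength (F : Multiset (Finset G.E)) : ℕ := (F.map Finset.card).sum

/-- A signed circuit cover: every edge is in at least one member. -/
def IsSignedCircuitCover (F : Multiset (Finset G.E)) : Prop :=
  (∀ S ∈ F, G.IsSignedCircuit S) ∧ ∀ e : G.E, 1 ≤ G.coverCount F e

/-- The length of a shortest signed circuit cover. -/
def SCC : ℕ := sInf { n | ∃ F, G.IsSignedCircuitCover F ∧ G.coverLength F = n }

/-- Whether edge `e` has exactly one endpoint in the vertex set `A`. -/
def crossesB (A : Finset G.V) (e : G.E) : Bool :=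
  Sym2.lift ⟨fun x y => Bool.xor (decide (x ∈ A)) (decide (y ∈ A)),
    fun x y => Bool.xor_comm _ _⟩ (G.ends e)

/-- Sign of `e` (`true` = negative) after switching at every vertex of `A`. -/
def negAfter (A : Finset G.V) (e : G.E) : Bool :=
  Bool.xor (G.neg e) (G.crossesB A e)

/-- Minimum number of negative edges in `S` over all switchings. -/
def negOf (S : Finset G.E) : ℕ :=
  sInf { n | ∃ A : Finset G.V, (S.filter fun e => G.negAfter A e = true).card = n }

/-- The negativeness of `G`. -/
def negativeness : ℕ := G.negOf Finset.univ

/-- The edges of `S` with exactly one endpoint in `U`: the edge boundary `δ(U)` inside `S`. -/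
def boundary (S : Finset G.E) (U : Finset G.V) : Finset G.E :=
  S.filter fun e => G.crossesB U e = true

/-- `b` is a bridge of the subgraph with edge set `S`. -/
def IsBridge (S : Finset G.E) (b : G.E) : Prop :=
  ∃ U : Finset G.V, G.boundary S U = {b}

/-- The subgraph with edge set `S` is bridgeless. -/
def Bridgeless (S : Finset G.E) : Prop := ∀ b ∈ S, ¬ G.IsBridge S b

/-- `G` is 2-edge-connected. -/
def TwoEdgeConnected : Prop :=
  G.Connected ∧ ∀ b : G.E, ¬ G.IsBridge Finset.univ b

/-- Edges of `S` lying in the same component (of the subgraph with edge set `S`)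
as the vertex `x`. -/
def compEdges (S : Finset G.E) (x : G.V) : Finset G.E :=
  S.filter fun e => ∃ u, u ∈ G.ends e ∧ G.Reach S x u

/-- A g-bridge: a bridge such that both components of `G - b` have even negativeness. -/
def IsGBridge (b : G.E) : Prop :=
  G.IsBridge Finset.univ b ∧
    ∃ x y : G.V, G.ends b = s(x, y) ∧
      Even (G.negOf (G.compEdges (Finset.univ.erase b) x)) ∧
      Even (G.negOf (G.compEdges (Finset.univ.erase b) y))

/-- `G` has no g-bridge (in any of its components). -/
def GBridgeless : Prop := ∀ b : G.E, ¬ G.IsGBridge b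

/-- Member of `B_g(G)`: a bridge such that at least one component of `G - b`
contains an odd number of negative edges. -/
def IsBgBridge (b : G.E) : Prop :=
  G.IsBridge Finset.univ b ∧
    ∃ x : G.V, x ∈ G.ends b ∧
      ¬ Even (G.negEdges (G.compEdges (Finset.univ.erase b) x)).card

/-- Member of `B_s(G)`: a bridge such that each of the two components of `G - b`
contains a negative edge. -/
def IsSBridge (b : G.E) : Prop :=
  G.IsBridge Finset.univ b ∧
    ∃ x y : G.V, G.ends b = s(x, y) ∧
      (G.negEdges (G.compEdges (Finset.univ.erase b) x)).Nonempty ∧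
      (G.negEdges (G.compEdges (Finset.univ.erase b) y)).Nonempty

/-- `G` is s-bridgeless: every edge lies in some signed circuit. -/
def SBridgeless : Prop := ∀ e : G.E, ∃ S : Finset G.E, G.IsSignedCircuit S ∧ e ∈ S

/-- `{e, f}` is a 2-edge-cut of `G`. -/
def IsTwoEdgeCut (e f : G.E) : Prop :=
  e ≠ f ∧ ∃ U : Finset G.V, G.boundary Finset.univ U = {e, f}

/-- `S_G(e) = {e} ∪ {f : {e,f} is a 2-edge-cut of G}`. -/
def SSet (e : G.E) : Finset G.E :=
  insert e (Finset.univ.filter fun f => G.IsTwoEdgeCut e f)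

/-- The edge set `R` spans an acyclic subgraph (every nonempty subset has a
vertex of degree one). -/
def AcyclicSet (R : Finset G.E) : Prop :=
  ∀ F ⊆ R, F.Nonempty → ∃ v : G.V, G.degIn F v = 1

/-- `T` is the edge set of a spanning tree of `G`. -/
def IsSpanningTree (T : Finset G.E) : Prop :=
  G.AcyclicSet T ∧ Nonempty G.V ∧ ∀ u v : G.V, G.Reach T u v

/-- `G` is eulerian: connected with all degrees even. -/
def Eulerian : Prop :=
  G.Connected ∧ ∀ v : G.V, Even (G.degIn Finset.univ v)

/-- The edge set `S` spans an eulerian subgraph. -/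
def IsEulerianSub (S : Finset G.E) : Prop :=
  S.Nonempty ∧ G.ConnOn S ∧ ∀ v ∈ G.support S, Even (G.degIn S v)

/-- The vertex class of `v` after contracting each member of `ℬ`. -/
def classOf (ℬ : Finset (Finset G.E)) (v : G.V) : Finset G.V :=
  Finset.univ.filter fun u => u = v ∨ ∃ B ∈ ℬ, v ∈ G.support B ∧ u ∈ G.support B

/-- Degree, in edge set `F`, of the contracted class of `v`. -/
def classDeg (ℬ : Finset (Finset G.E)) (F : Finset G.E) (v : G.V) : ℕ :=
  ∑ u ∈ G.classOf ℬ v, G.degIn F u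

/-- `ℬ` witnesses that the subgraph with edge set `S` is a generalized barbell:
`ℬ` is a family of vertex-disjoint eulerian subgraphs of `S`, the contraction
`S/(∪ℬ)` is acyclic, and for every vertex `x` of the contracted graph,
`|E_N(B_x)| ≡ |δ(V(B_x))| (mod 2)`. -/
def GenBarbellWitness (S : Finset G.E) (ℬ : Finset (Finset G.E)) : Prop :=
  (∀ B ∈ ℬ, B ⊆ S ∧ G.IsEulerianSub B) ∧
  (∀ B₁ ∈ ℬ, ∀ B₂ ∈ ℬ, B₁ ≠ B₂ → Disjoint (G.support B₁) (G.support B₂)) ∧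
  (∀ F ⊆ S \ ℬ.sup id, F.Nonempty → ∃ v : G.V, G.classDeg ℬ F v = 1) ∧
  (∀ B ∈ ℬ, (G.negEdges B).card ≡ (G.boundary S (G.support B)).card [MOD 2]) ∧
  (∀ v ∈ G.support S, (∀ B ∈ ℬ, v ∉ G.support B) → Even (G.boundary S {v}).card)

/-- The subgraph with edge set `S` is a generalized barbell. -/
def IsGenBarbell (S : Finset G.E) : Prop := ∃ ℬ, G.GenBarbellWitness S ℬ

end SignedMultigraph

namespace SignedMultigraph

variable {G : SignedMultigraph}

lemma mem_support {S : Finset G.E} {v : G.V} : v ∈ G.support S ↔ ∃ e ∈ S, v ∈ G.ends e := by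
  simp [support]

lemma exists_ends (e : G.E) : ∃ x y, G.ends e = s(x, y) :=
  Sym2.ind (f := fun z => ∃ x y, z = s(x, y)) (fun x y => ⟨x, y, rfl⟩) (G.ends e)

lemma disjoint_of_disjoint_support {S T : Finset G.E}
    (h : Disjoint (G.support S) (G.support T)) : Disjoint S T := by
  refine Finset.disjoint_left.2 fun e hS hT => ?_
  obtain ⟨x, y, hxy⟩ := exists_ends e
  have hx : x ∈ G.ends e := by simp [hxy]
  exact Finset.disjoint_left.1 h (mem_support.2 ⟨e, hS, hx⟩) (mem_support.2 ⟨e, hT, hx⟩)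

lemma weight_eq {e : G.E} {x y : G.V} (h : G.ends e = s(x, y)) (v : G.V) :
    (if G.ends e = Sym2.diag v then 2 else if v ∈ G.ends e then 1 else 0 : ℕ) =
      (if v = x then 1 else 0) + (if v = y then 1 else 0) := by
  rw [h]
  have hdiag : s(x, y) = Sym2.diag v ↔ v = x ∧ v = y := by
    simp [Sym2.diag, eq_comm]
  simp only [hdiag, Sym2.mem_iff]
  split_ifs <;> first | rfl | tauto

lemma degIn_insert {S : Finset G.E} {e : G.E} {x y : G.V} (he : e ∉ S)
    (h : G.ends e = s(x, y)) (v : G.V) :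
    G.degIn (insert e S) v =
      ((if v = x then 1 else 0) + (if v = y then 1 else 0)) + G.degIn S v := by
  rw [degIn, Finset.sum_insert he, weight_eq h, degIn]

lemma degIn_eq_zero {S : Finset G.E} {v : G.V} (h : v ∉ G.support S) : G.degIn S v = 0 := by
  refine Finset.sum_eq_zero fun e he => ?_
  have hv : v ∉ G.ends e := fun hv => h (mem_support.2 ⟨e, he, hv⟩)
  obtain ⟨x, y, hxy⟩ := exists_ends e
  rw [weight_eq hxy]
  simp_all

lemma degIn_sdiff_add {S T : Finset G.E} (h : T ⊆ S) (v : G.V) :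
    G.degIn (S \ T) v + G.degIn T v = G.degIn S v :=
  Finset.sum_sdiff h

lemma degIn_union {S T : Finset G.E} (h : Disjoint S T) (v : G.V) :
    G.degIn (S ∪ T) v = G.degIn S v + G.degIn T v :=
  Finset.sum_union h

lemma degIn_symmDiff (S T : Finset G.E) (v : G.V) :
    (G.degIn (symmDiff S T) v : ZMod 2) = G.degIn S v + G.degIn T v := by
  have h₁ := degIn_sdiff_add (G := G) (S := S) (T := S ∩ T) Finset.inter_subset_left v
  have h₂ := degIn_sdiff_add (G := G) (S := T) (T := S ∩ T) Finset.inter_subset_right v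
  have h₃ : symmDiff S T = (S \ (S ∩ T)) ∪ (T \ (S ∩ T)) := by
    ext e; simp only [Finset.mem_symmDiff, Finset.mem_union, Finset.mem_sdiff, Finset.mem_inter]
    tauto
  rw [h₃, degIn_union, ← h₁, ← h₂]
  · push_cast
    have : (G.degIn (S ∩ T) v : ZMod 2) + G.degIn (S ∩ T) v = 0 := CharTwo.add_self_eq_zero _
    linear_combination -this
  · refine Finset.disjoint_left.2 fun e => ?_
    simp only [Finset.mem_sdiff, Finset.mem_inter]
    tauto

lemma crossesB_eq {e : G.E} {x y : G.V} (h : G.ends e = s(x, y)) (W : Finset G.V) :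
    G.crossesB W e = true ↔ ¬ (x ∈ W ↔ y ∈ W) := by
  simp only [crossesB, h, Sym2.lift_mk]
  by_cases hx : x ∈ W <;> by_cases hy : y ∈ W <;> simp [hx, hy]

/-- The handshake lemma, relative to a vertex set and modulo two. -/
lemma sum_degIn (S : Finset G.E) (W : Finset G.V) :
    ∑ v ∈ W, (G.degIn S v : ZMod 2) = (G.boundary S W).card := by
  simp only [degIn, Nat.cast_sum]
  rw [Finset.sum_comm, boundary, Finset.card_filter, Nat.cast_sum]
  refine Finset.sum_congr rfl fun e _ => ?_
  obtain ⟨x, y, hxy⟩ := exists_ends e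
  simp only [weight_eq hxy, crossesB_eq hxy]
  push_cast
  rw [Finset.sum_add_distrib, Finset.sum_ite_eq', Finset.sum_ite_eq']
  by_cases hx : x ∈ W <;> by_cases hy : y ∈ W <;> simp [hx, hy, CharTwo.add_self_eq_zero]

lemma Adj.symm {S : Finset G.E} {u v : G.V} (h : G.Adj S u v) : G.Adj S v u := by
  obtain ⟨e, he, h⟩ := h
  exact ⟨e, he, h.trans Sym2.eq_swap⟩

lemma Reach.symm {S : Finset G.E} {u v : G.V} (h : G.Reach S u v) : G.Reach S v u :=
  haveI : Std.Symm (G.Adj S) := ⟨fun _ _ => Adj.symm⟩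
  Relation.ReflTransGen.stdSymm.symm _ _ h

lemma Reach.mono {S T : Finset G.E} (hST : S ⊆ T) {u v : G.V} (h : G.Reach S u v) :
    G.Reach T u v :=
  Relation.ReflTransGen.mono (fun _ _ ⟨e, he, h⟩ => ⟨e, hST he, h⟩) _ _ h

/-- `P` is the edge set of a possibly trivial path from `u` to `v`, built edge by edge. -/
inductive PathTo (u : G.V) : Finset G.E → G.V → Prop
  | nil : PathTo u ∅ u
  | snoc {P : Finset G.E} {v w : G.V} {e : G.E} (h : PathTo u P v) (he : G.ends e = s(v, w))
      (hw : w ∉ G.support P) (hwu : w ≠ u) : PathTo u (insert e P) w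

lemma support_insert {S : Finset G.E} {e : G.E} {x y : G.V} (h : G.ends e = s(x, y)) (v : G.V) :
    v ∈ G.support (insert e S) ↔ (v = x ∨ v = y) ∨ v ∈ G.support S := by
  simp [mem_support, h]

namespace PathTo

variable {u v : G.V} {P : Finset G.E}

lemma end_mem (h : PathTo u P v) : v ∈ G.support P ∨ v = u := by
  cases h with
  | nil => exact Or.inr rfl
  | snoc h he hw hwu => exact Or.inl ((support_insert he _).2 (by simp))

lemma ends_ne (h : PathTo u P v) {e : G.E} (he : e ∈ P) (x : G.V) : G.ends e ≠ s(x, x) := by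
  induction h with
  | nil => simp at he
  | @snoc P v w f h hf hw hwu ih =>
    rcases Finset.mem_insert.1 he with rfl | he
    · intro hx
      have hv := h.end_mem
      rw [hf, Sym2.eq_iff] at hx
      obtain ⟨rfl, rfl⟩ : v = x ∧ w = x := by tauto
      tauto
    · exact ih he

lemma degIn_add (h : PathTo u P v) (x : G.V) :
    G.degIn P x + (if x = u then 1 else 0) + (if x = v then 1 else 0) =
      if x ∈ G.support P ∨ x = u then 2 else 0 := by
  induction h with
  | nil => by_cases hx : x = u <;> simp [hx, degIn, mem_support]
  | @snoc P v w e h he hw hwu ih =>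
    have hv := h.end_mem
    rw [degIn_insert (fun h' => hw (mem_support.2 ⟨e, h', by simp [he]⟩)) he]
    simp only [support_insert he]
    by_cases hxw : x = w
    · subst hxw
      by_cases hxv : x = v
      · subst hxv; exact absurd hv (by tauto)
      · simp_all
    · by_cases hxv : x = v
      · subst hxv
        simp_all
        omega
      · simp_all

lemma degIn_cast (h : PathTo u P v) (x : G.V) :
    (G.degIn P x : ZMod 2) = (if x = u then 1 else 0) + (if x = v then 1 else 0) := by
  have h₁ := congrArg (Nat.cast : ℕ → ZMod 2) (h.degIn_add x)
  push_cast at h₁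
  have h₂ : ((if x ∈ G.support P ∨ x = u then 2 else 0 : ZMod 2)) = 0 := by
    split_ifs
    · exact CharTwo.two_eq_zero
    · rfl
  rw [h₂, add_assoc] at h₁
  exact CharTwo.add_eq_zero.1 h₁

lemma reach (h : PathTo u P v) : ∀ x ∈ G.support P, G.Reach P u x := by
  have aux : G.Reach P u v ∧ ∀ x ∈ G.support P, G.Reach P u x := by
    induction h with
    | nil => exact ⟨.refl, by simp [mem_support]⟩
    | @snoc P v w e h he hw hwu ih =>
      have hsub : P ⊆ insert e P := Finset.subset_insert _ _
      have hv : G.Reach (insert e P) u v := ih.1.mono hsub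
      have hw' : G.Reach (insert e P) u w := hv.tail ⟨e, by simp, he⟩
      refine ⟨hw', fun x hx => ?_⟩
      rcases (support_insert he x).1 hx with (rfl | rfl) | hx
      exacts [hv, hw', (ih.2 x hx).mono hsub]
  exact aux.2

lemma exists_prefix (h : PathTo u P v) {w : G.V} (hw : w ∈ G.support P ∨ w = u) :
    ∃ Q ⊆ P, PathTo u Q w := by
  induction h with
  | nil =>
    obtain rfl : w = u := by simpa [mem_support] using hw
    exact ⟨∅, by simp, .nil⟩
  | @snoc P v x e h he hx hxu ih =>
    by_cases hwP : w ∈ G.support P ∨ w = u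
    · obtain ⟨Q, hQ, h'⟩ := ih hwP
      exact ⟨Q, hQ.trans (Finset.subset_insert _ _), h'⟩
    · have hv := h.end_mem
      obtain rfl : w = x := by
        rw [support_insert he] at hw
        rcases hw with ((rfl | rfl) | hw) | hw <;> tauto
      exact ⟨_, subset_rfl, h.snoc he hx hxu⟩

lemma nonempty (h : PathTo u P v) (huv : u ≠ v) : P.Nonempty := by
  cases h with
  | nil => exact absurd rfl huv
  | snoc => simp

lemma isPath (h : PathTo u P v) (huv : u ≠ v) : G.IsPath P u v := by
  have hu : G.degIn P u = 1 := by
    have := h.degIn_add u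
    simp [huv] at this
    omega
  have hv : v ∈ G.support P := h.end_mem.resolve_right huv.symm
  refine ⟨h.nonempty huv, fun x hx y hy => (h.reach x hx).symm.trans (h.reach y hy), huv,
    ?_, hv, hu, ?_, fun w hw hwu hwv => ?_⟩
  · by_contra hc
    rw [degIn_eq_zero hc] at hu
    exact absurd hu (by simp)
  · have := h.degIn_add v
    simp [huv.symm, hv] at this
    omega
  · simpa [hw, hwu, hwv] using h.degIn_add w

end PathTo

lemma Reach.exists_pathTo {S : Finset G.E} {u v : G.V} (h : G.Reach S u v) :
    ∃ P ⊆ S, PathTo u P v := by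
  induction h with
  | refl => exact ⟨∅, by simp, .nil⟩
  | @tail v w _ hvw ih =>
    obtain ⟨P, hPS, hP⟩ := ih
    obtain ⟨e, he, hvw⟩ := hvw
    by_cases hw : w ∈ G.support P ∨ w = u
    · obtain ⟨Q, hQ, h'⟩ := hP.exists_prefix hw
      exact ⟨Q, hQ.trans hPS, h'⟩
    · push Not at hw
      exact ⟨insert e P, Finset.insert_subset he hPS, hP.snoc hvw hw.1 hw.2⟩

/-- Inside a connected edge set one can realise any even set of vertices, or any odd set up to
one vertex, as the set of vertices of odd degree. -/
lemma ConnOn.exists_join {C : Finset G.E} (hC : G.ConnOn C) (T : Finset G.V)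
    (hT : T ⊆ G.support C) :
    ∃ A ⊆ C, ∃ T' ⊆ T, T'.card ≤ 1 ∧ (T'.card : ZMod 2) = T.card ∧ (T.card ≤ 1 → A = ∅) ∧
      ∀ v, (G.degIn A v : ZMod 2) = (if v ∈ T then 1 else 0) + (if v ∈ T' then 1 else 0) := by
  induction hn : T.card using Nat.strong_induction_on generalizing T with
  | _ n ih =>
    subst hn
    by_cases h1 : T.card ≤ 1
    · refine ⟨∅, by simp, T, subset_rfl, h1, rfl, fun _ => rfl, fun v => ?_⟩
      rw [CharTwo.add_self_eq_zero]
      simp [degIn]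
    · obtain ⟨a, ha, b, hb, hab⟩ := Finset.one_lt_card.1 (not_le.1 h1)
      have hb' : b ∈ T.erase a := Finset.mem_erase.2 ⟨hab.symm, hb⟩
      have hc : ((T.erase a).erase b).card + 2 = T.card := by
        have h₁ := Finset.card_erase_add_one hb'
        have h₂ := Finset.card_erase_add_one ha
        omega
      have hsub : (T.erase a).erase b ⊆ T :=
        (Finset.erase_subset _ _).trans (Finset.erase_subset _ _)
      obtain ⟨A, hA, T', hT', hcard, hpar, -, hdeg⟩ :=
        ih _ (by omega) ((T.erase a).erase b) (hsub.trans hT) rfl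
      obtain ⟨Q, hQ, hpath⟩ := (hC a (hT ha) b (hT hb)).exists_pathTo
      refine ⟨symmDiff A Q, ?_, T', hT'.trans hsub, hcard, ?_, fun h => absurd h h1, fun v => ?_⟩
      · intro e he
        rcases Finset.mem_symmDiff.1 he with h | h
        exacts [hA h.1, hQ h.1]
      · rw [hpar, ← hc]
        push_cast
        rw [CharTwo.two_eq_zero (R := ZMod 2), add_zero]
      · rw [degIn_symmDiff, hdeg, hpath.degIn_cast]
        by_cases hva : v = a
        · subst hva; simp [hab, ha, add_comm]
        · by_cases hvb : v = b
          · subst hvb; simp [hva, hb, add_comm]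
          · simp [hva, hvb]

lemma coverCount_add (F₁ F₂ : Multiset (Finset G.E)) (e : G.E) :
    G.coverCount (F₁ + F₂) e = G.coverCount F₁ e + G.coverCount F₂ e := by
  simp [coverCount]

lemma coverCount_cons (S : Finset G.E) (F : Multiset (Finset G.E)) (e : G.E) :
    G.coverCount (S ::ₘ F) e = (if e ∈ S then 1 else 0) + G.coverCount F e := by
  by_cases h : e ∈ S <;> simp [coverCount, h, add_comm]

lemma coverCount_map {ι : Type*} (U : Finset ι) (B : ι → Finset G.E) (e : G.E) :
    G.coverCount (U.val.map B) e = ∑ i ∈ U, if e ∈ B i then 1 else 0 := by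
  induction U using Finset.induction_on with
  | empty => simp [coverCount]
  | insert a U ha ih =>
    rw [Finset.insert_val_of_notMem ha, Multiset.map_cons, coverCount_cons, ih,
      Finset.sum_insert ha]

/-- Every component of an edge set has an even number of vertices of odd degree. -/
lemma exists_reach_of_odd {ι : Type*} {J : Finset G.E} {U : Finset ι} {r : ι → G.V}
    (hJ : ∀ v, (G.degIn J v : ZMod 2) = ∑ i ∈ U, if v = r i then 1 else 0) {i : ι} (hi : i ∈ U) :
    ∃ j ∈ U, j ≠ i ∧ G.Reach J (r i) (r j) := by
  by_contra! hcon
  have h₁ := sum_degIn J (Finset.univ.filter fun v => G.Reach J (r i) v)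
  have h₂ : G.boundary J (Finset.univ.filter fun v => G.Reach J (r i) v) = ∅ := by
    refine Finset.filter_eq_empty_iff.2 fun e he => ?_
    obtain ⟨x, y, hxy⟩ := exists_ends e
    rw [crossesB_eq hxy, not_not, Finset.mem_filter_univ, Finset.mem_filter_univ]
    have hadj : G.Adj J x y := ⟨e, he, hxy⟩
    exact ⟨fun h => h.tail hadj, fun h => h.tail hadj.symm⟩
  rw [h₂, Finset.sum_congr rfl (fun v _ => hJ v), Finset.sum_comm] at h₁
  simp only [Finset.sum_ite_eq', Finset.mem_filter_univ, Finset.card_empty, Nat.cast_zero] at h₁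
  rw [Finset.sum_eq_single_of_mem i hi fun j hj hji => if_neg (hcon j hj hji),
    if_pos (show G.Reach J (r i) (r i) from Relation.ReflTransGen.refl)] at h₁
  exact one_ne_zero h₁

/-- If the vertices of odd degree of `J` form a transversal of a family of vertex-disjoint
unbalanced circuits, then the circuits can be paired up into long barbells whose connecting paths
are edge-disjoint and contained in `J`. -/
lemma exists_longBarbells {ι : Type*} (B : ι → Finset G.E) (J : Finset G.E) (U : Finset ι)
    (r : ι → G.V) (hB : ∀ i ∈ U, G.IsUnbalancedCircuit (B i))
    (hdisj : ∀ i ∈ U, ∀ j ∈ U, i ≠ j → Disjoint (G.support (B i)) (G.support (B j)))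
    (hr : ∀ i ∈ U, r i ∈ G.support (B i))
    (hJ : ∀ v, (G.degIn J v : ZMod 2) = ∑ i ∈ U, if v = r i then 1 else 0) :
    ∃ F : Multiset (Finset G.E), (∀ S ∈ F, G.IsLongBarbell S) ∧ ∀ e,
      (∑ i ∈ U, if e ∈ B i then 1 else 0) ≤ G.coverCount F e ∧
      G.coverCount F e ≤ (∑ i ∈ U, if e ∈ B i then 1 else 0) + if e ∈ J then 1 else 0 := by
  induction hn : J.card using Nat.strong_induction_on generalizing J U r with
  | _ n ih =>
    subst hn
    rcases U.eq_empty_or_nonempty with rfl | ⟨i, hi⟩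
    · exact ⟨0, by simp, by simp [coverCount]⟩
    have hlt : ∀ D ⊆ J, D.Nonempty → (J \ D).card < J.card := fun D hD hne =>
      Finset.card_lt_card (Finset.sdiff_ssubset hD hne)
    have hdeg : ∀ D ⊆ J, ∀ v, (G.degIn (J \ D) v : ZMod 2) = G.degIn J v + G.degIn D v := by
      intro D hD v
      rw [← degIn_sdiff_add hD v, Nat.cast_add, add_assoc, CharTwo.add_self_eq_zero, add_zero]
    -- moving the root of a circuit along a part of `J` that returns to the circuit
    have move : ∀ k ∈ U, ∀ w ∈ G.support (B k), ∀ D ⊆ J, D.Nonempty →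
        (∀ v, (G.degIn D v : ZMod 2) = (if v = r k then 1 else 0) + if v = w then 1 else 0) →
        ∃ F : Multiset (Finset G.E), (∀ S ∈ F, G.IsLongBarbell S) ∧ ∀ e,
          (∑ i ∈ U, if e ∈ B i then 1 else 0) ≤ G.coverCount F e ∧
          G.coverCount F e ≤ (∑ i ∈ U, if e ∈ B i then 1 else 0) + if e ∈ J then 1 else 0 := by
      intro k hk w hw D hD hne hDdeg
      obtain ⟨F, hF, hcov⟩ := ih _ (hlt D hD hne) (J \ D) U (Function.update r k w) hB hdisj
        (by
          intro l hl
          by_cases hlk : l = k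
          · subst hlk; simpa using hw
          · simpa [hlk] using hr l hl)
        (by
          intro v
          rw [hdeg D hD, hJ, hDdeg, ← Finset.add_sum_erase U _ hk, ← Finset.add_sum_erase U _ hk,
            Finset.sum_congr rfl (g := fun l => if v = r l then (1 : ZMod 2) else 0)
              (s₁ := U.erase k) (f := fun l => if v = Function.update r k w l then 1 else 0)
              fun l hl => by simp [Finset.ne_of_mem_erase hl]]
          rw [Function.update_self]
          have := CharTwo.add_self_eq_zero (if v = r k then (1 : ZMod 2) else 0)
          linear_combination this) rfl
      refine ⟨F, hF, fun e => ⟨(hcov e).1, (hcov e).2.trans ?_⟩⟩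
      gcongr
      by_cases he : e ∈ J <;> by_cases he' : e ∈ D <;> simp [he, he']
    obtain ⟨j, hj, hji, hreach⟩ := exists_reach_of_odd hJ hi
    obtain ⟨P, hPJ, hP⟩ := hreach.exists_pathTo
    have hne : r i ≠ r j := fun h =>
      Finset.disjoint_left.1 (hdisj i hi j hj hji.symm) (hr i hi) (h ▸ hr j hj)
    by_cases hmi : ∃ w ∈ G.support P, w ∈ G.support (B i) ∧ w ≠ r i
    · obtain ⟨w, hwP, hwB, hw⟩ := hmi
      obtain ⟨Q, hQP, hQ⟩ := hP.exists_prefix (Or.inl hwP)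
      exact move i hi w hwB Q (hQP.trans hPJ) (hQ.nonempty hw.symm) hQ.degIn_cast
    by_cases hmj : ∃ w ∈ G.support P, w ∈ G.support (B j) ∧ w ≠ r j
    · obtain ⟨w, hwP, hwB, hw⟩ := hmj
      obtain ⟨Q, hQP, hQ⟩ := hP.exists_prefix (Or.inl hwP)
      have hPQ : ∀ v, (G.degIn (P \ Q) v : ZMod 2) =
          (if v = r j then 1 else 0) + if v = w then 1 else 0 := by
        intro v
        have h₁ := congrArg (Nat.cast : ℕ → ZMod 2) (degIn_sdiff_add hQP v)
        push_cast at h₁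
        rw [hQ.degIn_cast, hP.degIn_cast] at h₁
        have h₂ := CharTwo.add_self_eq_zero (if v = w then (1 : ZMod 2) else 0)
        linear_combination h₁ - h₂
      refine move j hj w hwB (P \ Q) (Finset.sdiff_subset.trans hPJ) ?_ hPQ
      by_contra hemp
      have := hPQ (r j)
      rw [Finset.not_nonempty_iff_eq_empty.1 hemp] at this
      simp [degIn, hw.symm] at this
    push Not at hmi hmj
    have hpath := hP.isPath hne
    have hsup : ∀ k, r k ∈ G.support P → r k ∈ G.support (B k) →
        (∀ w ∈ G.support P, w ∈ G.support (B k) → w = r k) →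
        G.support P ∩ G.support (B k) = {r k} := by
      intro k h₁ h₂ h₃
      ext w
      simp only [Finset.mem_inter, Finset.mem_singleton]
      exact ⟨fun h => h₃ w h.1 h.2, fun h => h ▸ ⟨h₁, h₂⟩⟩
    have hedge : ∀ k, (∀ w ∈ G.support P, w ∈ G.support (B k) → w = r k) →
        Disjoint P (B k) := by
      intro k h₃
      refine Finset.disjoint_left.2 fun e he he' => ?_
      obtain ⟨x, y, hxy⟩ := exists_ends e
      have hx := h₃ x (mem_support.2 ⟨e, he, by simp [hxy]⟩) (mem_support.2 ⟨e, he', by simp [hxy]⟩)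
      have hy := h₃ y (mem_support.2 ⟨e, he, by simp [hxy]⟩) (mem_support.2 ⟨e, he', by simp [hxy]⟩)
      exact hP.ends_ne he (r k) (by rw [hxy, hx, hy])
    have hbar : G.IsLongBarbell (B i ∪ B j ∪ P) :=
      ⟨B i, B j, P, r i, r j, hB i hi, hB j hj, hdisj i hi j hj hji.symm, hpath,
        hsup i hpath.2.2.2.1 (hr i hi) hmi, hsup j hpath.2.2.2.2.1 (hr j hj) hmj,
        hedge i hmi, hedge j hmj, rfl⟩
    have hj' : j ∈ U.erase i := Finset.mem_erase.2 ⟨hji, hj⟩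
    have hsub : ∀ k ∈ (U.erase i).erase j, k ∈ U := fun k hk =>
      Finset.mem_of_mem_erase (Finset.mem_of_mem_erase hk)
    obtain ⟨F, hF, hcov⟩ := ih _ (hlt P hPJ hpath.1) (J \ P) ((U.erase i).erase j) r
      (fun k hk => hB k (hsub k hk))
      (fun k hk l hl => hdisj k (hsub k hk) l (hsub l hl)) (fun k hk => hr k (hsub k hk))
      (by
        intro v
        rw [hdeg P hPJ, hJ, hP.degIn_cast, ← Finset.add_sum_erase U _ hi,
          ← Finset.add_sum_erase (U.erase i) _ hj']
        have h₁ := CharTwo.add_self_eq_zero (if v = r i then (1 : ZMod 2) else 0)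
        have h₂ := CharTwo.add_self_eq_zero (if v = r j then (1 : ZMod 2) else 0)
        linear_combination h₁ + h₂) rfl
    refine ⟨(B i ∪ B j ∪ P) ::ₘ F, by simpa only [Multiset.forall_mem_cons] using ⟨hbar, hF⟩, fun e => ?_⟩
    have hc := hcov e
    rw [coverCount_cons, ← Finset.add_sum_erase U _ hi, ← Finset.add_sum_erase (U.erase i) _ hj']
    have hij : e ∈ B i → e ∉ B j := fun h => Finset.disjoint_left.1
      (disjoint_of_disjoint_support (hdisj i hi j hj hji.symm)) h
    have hPJ' : e ∈ P → e ∈ J := fun h => hPJ h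
    simp only [Finset.mem_union, Finset.mem_sdiff] at hc ⊢
    by_cases h₁ : e ∈ B i <;> by_cases h₂ : e ∈ B j <;> by_cases h₃ : e ∈ P <;>
      by_cases h₄ : e ∈ J <;> simp [h₁, h₂, h₃, h₄] at hc hij hPJ' ⊢ <;> omega

end SignedMultigraph

/-- Let `H` be a generalized barbell with vertex-disjoint eulerian
subgraphs `B₁, …, B_t`, where `B₁, …, B_s` (`2 ≤ s ≤ t`) are exactly those
corresponding to degree-1 vertices of the contraction `X = H/(B₁ ∪ ⋯ ∪ B_t)`.
If each `B_i` is a circuit, then there is a family `F` of signed circuits of `H`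
covering each edge of `B₁ ∪ ⋯ ∪ B_s` exactly once, each edge of
`B_{s+1} ∪ ⋯ ∪ B_t` once or twice, and every other edge at most once. -/
theorem genBarbell_circuit_cover (G : SignedMultigraph) (t s : ℕ)
    (B : Fin t → Finset G.E) (hinj : Function.Injective B)
    (hwit : G.GenBarbellWitness Finset.univ (Finset.univ.image B))
    (hs2 : 2 ≤ s) (hst : s ≤ t)
    (hdeg1 : ∀ i : Fin t,
      (G.boundary Finset.univ (G.support (B i))).card = 1 ↔ (i : ℕ) < s)
    (hcirc : ∀ i : Fin t, G.IsCircuit (B i)) :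
    ∃ F : Multiset (Finset G.E),
      (∀ S ∈ F, G.IsSignedCircuit S) ∧
      (∀ e : G.E, (∃ i : Fin t, (i : ℕ) < s ∧ e ∈ B i) → G.coverCount F e = 1) ∧
      (∀ e : G.E, (∃ i : Fin t, s ≤ (i : ℕ) ∧ e ∈ B i) →
        1 ≤ G.coverCount F e ∧ G.coverCount F e ≤ 2) ∧
      (∀ e : G.E, (∀ i : Fin t, e ∉ B i) → G.coverCount F e ≤ 1) := by
  have hdisj : ∀ i j, i ≠ j → Disjoint (G.support (B i)) (G.support (B j)) := fun i j hij =>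
    hwit.2.1 _ (by simp) _ (by simp) (hinj.ne hij)
  have hneg : ∀ i, ((G.negEdges (B i)).card : ZMod 2) =
      (G.boundary Finset.univ (G.support (B i))).card := fun i =>
    (ZMod.natCast_eq_natCast_iff _ _ 2).2 (hwit.2.2.2.1 _ (by simp))
  -- the edges of the contracted graph that are not loops there
  set R : Finset G.E := Finset.univ.filter fun e => ∀ i, ∃ v ∈ G.ends e, v ∉ G.support (B i)
    with hR
  have hdegR : ∀ v, (∀ i, v ∉ G.support (B i)) → (G.degIn R v : ZMod 2) = 0 := by
    intro v hv
    have h₁ : G.degIn R v = G.degIn Finset.univ v := by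
      refine Finset.sum_subset (Finset.subset_univ _) fun e _ he => ?_
      have hve : v ∉ G.ends e := fun hve => he (by simpa [hR] using fun i => ⟨v, hve, hv i⟩)
      obtain ⟨x, y, hxy⟩ := SignedMultigraph.exists_ends e
      rw [SignedMultigraph.weight_eq hxy]
      simp_all
    rw [h₁]
    by_cases hs : v ∈ G.support Finset.univ
    · have h₂ := SignedMultigraph.sum_degIn (Finset.univ : Finset G.E) {v}
      rw [Finset.sum_singleton] at h₂
      rw [h₂, ZMod.natCast_eq_zero_iff_even]
      exact hwit.2.2.2.2 v hs (by simpa using hv)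
    · rw [SignedMultigraph.degIn_eq_zero hs, Nat.cast_zero]
  have hboundary : ∀ i, G.boundary R (G.support (B i)) =
      G.boundary Finset.univ (G.support (B i)) := by
    intro i
    ext e
    simp only [SignedMultigraph.boundary, Finset.mem_filter, Finset.mem_univ, true_and,
      and_iff_right_iff_imp, hR]
    obtain ⟨x, y, hxy⟩ := SignedMultigraph.exists_ends e
    rw [SignedMultigraph.crossesB_eq hxy, hxy]
    intro h j
    by_contra! hcon
    have hx := hcon x (by simp)
    have hy := hcon y (by simp)
    by_cases hij : i = j
    · subst hij; tauto
    · have := Finset.disjoint_left.1 (hdisj i j hij)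
      tauto
  set T : Fin t → Finset G.V := fun i =>
    (G.support (B i)).filter fun v => (G.degIn R v : ZMod 2) ≠ 0 with hT
  have hite : ∀ v, (G.degIn R v : ZMod 2) = if (G.degIn R v : ZMod 2) ≠ 0 then 1 else 0 := by
    intro v
    generalize (G.degIn R v : ZMod 2) = a
    revert a
    decide
  have hTcard : ∀ i, ((T i).card : ZMod 2) = (G.negEdges (B i)).card := by
    intro i
    rw [hneg, ← hboundary, ← SignedMultigraph.sum_degIn, Finset.sum_congr rfl fun v _ => hite v,
      Finset.sum_boole]
  have hTleaf : ∀ i : Fin t, (i : ℕ) < s → (T i).card ≤ 1 := by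
    intro i hi
    obtain ⟨e, he⟩ := Finset.card_eq_one.1 ((hdeg1 i).2 hi)
    have hmem : ∀ v ∈ T i, v ∈ G.ends e := by
      intro v hv
      obtain ⟨hvW, hv0⟩ := Finset.mem_filter.1 hv
      have hvR : v ∈ G.support R := by
        by_contra h
        exact hv0 (by rw [SignedMultigraph.degIn_eq_zero h, Nat.cast_zero])
      obtain ⟨f, hf, hvf⟩ := SignedMultigraph.mem_support.1 hvR
      have hfb : f ∈ G.boundary Finset.univ (G.support (B i)) := by
        refine Finset.mem_filter.2 ⟨Finset.mem_univ _, ?_⟩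
        obtain ⟨x, y, hxy⟩ := SignedMultigraph.exists_ends f
        obtain ⟨w, hwf, hw⟩ := (Finset.mem_filter.1 hf).2 i
        rw [SignedMultigraph.crossesB_eq hxy]
        rw [hxy, Sym2.mem_iff] at hvf hwf
        rcases hvf with rfl | rfl <;> rcases hwf with rfl | rfl <;> tauto
      rw [he, Finset.mem_singleton] at hfb
      exact hfb ▸ hvf
    refine Finset.card_le_one.2 fun v hv w hw => ?_
    by_contra hvw
    have heb : e ∈ G.boundary Finset.univ (G.support (B i)) := by simp [he]
    have hxy : G.ends e = s(v, w) := (Sym2.mem_and_mem_iff hvw).1 ⟨hmem v hv, hmem w hw⟩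
    have hcross := (Finset.mem_filter.1 heb).2
    rw [SignedMultigraph.crossesB_eq hxy] at hcross
    exact hcross (iff_of_true (Finset.mem_filter.1 hv).1 (Finset.mem_filter.1 hw).1)
  choose A hAB T' hT'T hT'card hT'par hAempty hAdeg using fun i =>
    (hcirc i).2.1.exists_join (T i) (Finset.filter_subset _ _)
  have hroot : ∀ i, ∃ x ∈ G.support (B i), ∀ v,
      (v ∈ T' i ↔ ¬ Even (G.negEdges (B i)).card ∧ v = x) := by
    intro i
    have hpar : ((T' i).card : ZMod 2) = (G.negEdges (B i)).card := (hT'par i).trans (hTcard i)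
    rcases Nat.le_one_iff_eq_zero_or_eq_one.1 (hT'card i) with h | h
    · rw [h, Nat.cast_zero] at hpar
      have heven := (ZMod.natCast_eq_zero_iff_even).1 hpar.symm
      obtain ⟨e, he⟩ := (hcirc i).1
      obtain ⟨x, y, hxy⟩ := SignedMultigraph.exists_ends e
      refine ⟨x, SignedMultigraph.mem_support.2 ⟨e, he, by simp [hxy]⟩, fun v => ?_⟩
      simp [heven, Finset.card_eq_zero.1 h]
    · rw [h, Nat.cast_one] at hpar
      have hodd : ¬ Even (G.negEdges (B i)).card := by
        rw [← ZMod.natCast_eq_zero_iff_even, ← hpar]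
        exact one_ne_zero
      obtain ⟨x, hx⟩ := Finset.card_eq_one.1 h
      refine ⟨x, Finset.filter_subset _ _ (hT'T i (by simp [hx])), fun v => ?_⟩
      simp [hodd, hx]
  choose r hrB hr using hroot
  set U : Finset (Fin t) := Finset.univ.filter fun i => ¬ Even (G.negEdges (B i)).card with hU
  set J : Finset G.E := R ∪ Finset.univ.biUnion A with hJ
  have hBdisj : ∀ i j, i ≠ j → Disjoint (B i) (B j) := fun i j hij =>
    SignedMultigraph.disjoint_of_disjoint_support (hdisj i j hij)
  have hRB : ∀ i, Disjoint R (B i) := by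
    refine fun i => Finset.disjoint_left.2 fun e he heB => ?_
    obtain ⟨v, hv, hvB⟩ := (Finset.mem_filter.1 he).2 i
    exact hvB (SignedMultigraph.mem_support.2 ⟨e, heB, hv⟩)
  have hdegJ : ∀ v, (G.degIn J v : ZMod 2) = ∑ i ∈ U, if v = r i then 1 else 0 := by
    intro v
    have h₁ : G.degIn J v = G.degIn R v + ∑ i, G.degIn (A i) v := by
      rw [hJ, SignedMultigraph.degIn_union]
      · congr 1
        exact Finset.sum_biUnion fun i _ j _ hij =>
          (hBdisj i j hij).mono (hAB i) (hAB j)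
      · exact Finset.disjoint_biUnion_right _ _ _ |>.2 fun i _ =>
          (hRB i).mono_right (hAB i)
    have h₂ : ∑ i, (if v ∈ T i then (1 : ZMod 2) else 0) = G.degIn R v := by
      by_cases hv : ∃ i, v ∈ G.support (B i)
      · obtain ⟨i, hi⟩ := hv
        rw [Finset.sum_eq_single_of_mem i (Finset.mem_univ _), hite v]
        · simp [hT, hi]
        · intro j _ hji
          exact if_neg fun h => Finset.disjoint_left.1 (hdisj j i hji) (Finset.mem_filter.1 h).1 hi
      · push Not at hv
        rw [hdegR v hv]
        exact Finset.sum_eq_zero fun i _ => if_neg fun h => hv i (Finset.mem_filter.1 h).1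
    rw [h₁, Nat.cast_add, Nat.cast_sum, Finset.sum_congr rfl fun i _ => hAdeg i v,
      Finset.sum_add_distrib, h₂, ← add_assoc, CharTwo.add_self_eq_zero, zero_add, hU,
      Finset.sum_filter]
    refine Finset.sum_congr rfl fun i _ => ?_
    rw [← ite_and]
    exact if_congr (hr i v) rfl rfl
  obtain ⟨F, hF, hcov⟩ := SignedMultigraph.exists_longBarbells B J U r
    (fun i hi => ⟨hcirc i, (Finset.mem_filter.1 hi).2⟩) (fun i _ j _ => hdisj i j)
    (fun i _ => hrB i) hdegJ
  have hcount : ∀ e, (∑ i, if e ∈ B i then 1 else 0) ≤ G.coverCount (Uᶜ.val.map B + F) e ∧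
      G.coverCount (Uᶜ.val.map B + F) e ≤
        (∑ i, if e ∈ B i then 1 else 0) + if e ∈ J then 1 else 0 := by
    intro e
    rw [SignedMultigraph.coverCount_add, SignedMultigraph.coverCount_map,
      ← Finset.sum_add_sum_compl U]
    have := hcov e
    omega
  have hone : ∀ e i, e ∈ B i → (∑ i, if e ∈ B i then 1 else 0) = 1 := by
    intro e i he
    rw [Finset.sum_eq_single_of_mem i (Finset.mem_univ _), if_pos he]
    exact fun j _ hji => if_neg fun h => Finset.disjoint_left.1 (hBdisj j i hji) h he
  refine ⟨Uᶜ.val.map B + F, fun S hS => ?_, ?_, ?_, fun e he => ?_⟩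
  · rcases Multiset.mem_add.1 hS with hS | hS
    · obtain ⟨i, hi, rfl⟩ := Multiset.mem_map.1 hS
      exact Or.inl ⟨hcirc i, by simpa [hU] using hi⟩
    · exact Or.inr (Or.inr (hF S hS))
  · rintro e ⟨i, hi, he⟩
    have heJ : e ∉ J := by
      rw [hJ, Finset.mem_union, Finset.mem_biUnion]
      rintro (h | ⟨j, -, h⟩)
      · exact Finset.disjoint_left.1 (hRB i) h he
      · by_cases hji : j = i
        · subst hji
          simp [hAempty j (hTleaf j hi)] at h
        · exact Finset.disjoint_left.1 (hBdisj j i hji) (hAB j h) he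
    have := hcount e
    rw [hone e i he, if_neg heJ] at this
    omega
  · rintro e ⟨i, -, he⟩
    have := hcount e
    rw [hone e i he] at this
    split_ifs at this <;> omega
  · have := (hcount e).2
    rw [Finset.sum_eq_zero fun i _ => if_neg (he i)] at this
    split_ifs at this <;> omega
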